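/- Let X be a Poisson random variable with mean m > 0, let r ≥ 1 be an integer, let a be a real number, and let f : ℕ → ℝ. Then the following are equivalent: (i) E[|(X − a)^r·f(X)|] < ∞; (ii) E[X^r·|f(X)|] < ∞; (iii) E[X^{r-1}·|Δf(X)|] < ∞; (iv) E[|(X − a)^{r-1}·Δf(X)|] < ∞; where Δf(j) := f(j+1) − f(j). -/

import Mathlib

/-- The Poisson probability mass at `j` for a Poisson distribution with mean `m`:
`P(X = j) = e^{-m} m^j / j!`. -/
noncomputable def poissonWeight (m : ℝ) (j : ℕ) : ℝ :=
  Real.exp (-m) * m ^ j / (Nat.factorial j : ℝ)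

open Filter Asymptotics Finset

theorem poissonWeight_nonneg {m : ℝ} (hm : 0 < m) (j : ℕ) : 0 ≤ poissonWeight m j := by
  unfold poissonWeight
  positivity

theorem succ_mul_poissonWeight_succ (m : ℝ) (j : ℕ) :
    ((j : ℝ) + 1) * poissonWeight m (j + 1) = m * poissonWeight m j := by
  have h : (Nat.factorial j : ℝ) ≠ 0 := by positivity
  have h' : (j : ℝ) + 1 ≠ 0 := by positivity
  unfold poissonWeight
  rw [Nat.factorial_succ]
  push_cast
  field_simp
  ring

theorem isTheta_natCast_sub_const (a : ℝ) :
    (fun j : ℕ => (j : ℝ) - a) =Θ[atTop] fun j : ℕ => (j : ℝ) := by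
  have h : (fun _ : ℕ => a) =o[atTop] fun j : ℕ => (j : ℝ) :=
    isLittleO_const_left.2 <| Or.inr <|
      tendsto_norm_atTop_atTop.comp tendsto_natCast_atTop_atTop
  exact (IsEquivalent.refl.sub_isLittleO h).isTheta

theorem summable_abs_natCast_sub_pow_mul_iff (a : ℝ) (r : ℕ) (g w : ℕ → ℝ) :
    (Summable fun j : ℕ => |((j : ℝ) - a) ^ r * g j| * w j) ↔
      (Summable fun j : ℕ => (j : ℝ) ^ r * |g j| * w j) := by
  have h : (fun j : ℕ => |((j : ℝ) - a) ^ r * g j| * w j) =Θ[atTop]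
      fun j : ℕ => (j : ℝ) ^ r * |g j| * w j := by
    refine IsTheta.mul ?_ (isTheta_refl _ _)
    simp only [abs_mul]
    refine IsTheta.mul ?_ (isTheta_refl _ _)
    simpa only [← Real.norm_eq_abs, isTheta_norm_left] using (isTheta_natCast_sub_const a).pow r
  exact ⟨fun hs => summable_of_isBigO_nat hs h.2, fun hs => summable_of_isBigO_nat hs h.1⟩

/-- A nonnegative sequence that contracts by a factor `1 / 2` up to a summable error is summable. -/
theorem summable_of_succ_le_half_add {u e : ℕ → ℝ} (hu : ∀ n, 0 ≤ u n) (he0 : ∀ n, 0 ≤ e n)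
    (he : Summable e) (h : ∀ᶠ n in atTop, u (n + 1) ≤ u n / 2 + e n) : Summable u := by
  obtain ⟨N, hN⟩ := eventually_atTop.1 h
  have he' : Summable fun n => e (n + N) := (summable_nat_add_iff N).2 he
  refine (summable_nat_add_iff N).1 ?_
  have key : ∀ n, ∑ i ∈ range n, u (i + N) + 2 * u (n + N) ≤
      2 * u N + 2 * ∑ i ∈ range n, e (i + N) := by
    intro n
    induction n with
    | zero => simp
    | succ n ih =>
      rw [sum_range_succ, sum_range_succ, show n + 1 + N = n + N + 1 by ring]
      linarith [hN (n + N) (Nat.le_add_left N n)]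
  refine summable_of_sum_range_le (c := 2 * u N + 2 * ∑' i, e (i + N)) (fun n => hu _) fun n => ?_
  linarith [key n, hu (n + N), he'.sum_le_tsum (range n) fun i _ => he0 (i + N)]

theorem summable_pow_mul_abs_sub_mul_poissonWeight {m : ℝ} (hm : 0 < m) (s : ℕ) (f : ℕ → ℝ)
    (h : Summable fun j : ℕ => (j : ℝ) ^ (s + 1) * |f j| * poissonWeight m j) :
    Summable fun j : ℕ => (j : ℝ) ^ s * |f (j + 1) - f j| * poissonWeight m j := by
  have h' := (((summable_nat_add_iff 1).2 h).mul_left m⁻¹).add h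
  refine summable_of_isBigO_nat h' (IsBigO.of_bound 1 ?_)
  filter_upwards [eventually_ge_atTop 1] with j hj
  have hj' : (1 : ℝ) ≤ j := by exact_mod_cast hj
  have hw := poissonWeight_nonneg hm j
  have hw' := poissonWeight_nonneg hm (j + 1)
  rw [Real.norm_of_nonneg (by positivity), Real.norm_of_nonneg (by positivity), one_mul]
  have hshift : m⁻¹ * (((j + 1 : ℕ) : ℝ) ^ (s + 1) * |f (j + 1)| * poissonWeight m (j + 1)) =
      ((j : ℝ) + 1) ^ s * |f (j + 1)| * poissonWeight m j := by
    have e := succ_mul_poissonWeight_succ m j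
    push_cast
    calc _ = m⁻¹ * (((j : ℝ) + 1) ^ s * |f (j + 1)| *
          (((j : ℝ) + 1) * poissonWeight m (j + 1))) := by ring
      _ = _ := by rw [e]; field_simp
  rw [hshift]
  calc (j : ℝ) ^ s * |f (j + 1) - f j| * poissonWeight m j
      ≤ (j : ℝ) ^ s * (|f (j + 1)| + |f j|) * poissonWeight m j := by
        gcongr
        exact abs_sub _ _
    _ = (j : ℝ) ^ s * |f (j + 1)| * poissonWeight m j +
        (j : ℝ) ^ s * |f j| * poissonWeight m j := by ring
    _ ≤ _ := by
        gcongr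
        · linarith
        · exact Nat.le_succ s

theorem summable_pow_succ_mul_abs_mul_poissonWeight {m : ℝ} (hm : 0 < m) (s : ℕ) (f : ℕ → ℝ)
    (h : Summable fun j : ℕ => (j : ℝ) ^ s * |f (j + 1) - f j| * poissonWeight m j) :
    Summable fun j : ℕ => (j : ℝ) ^ (s + 1) * |f j| * poissonWeight m j := by
  have hw := poissonWeight_nonneg hm
  refine summable_of_succ_le_half_add (fun j => mul_nonneg (by positivity) (hw j))
    (fun j => mul_nonneg (by positivity) (mul_nonneg (by positivity) (hw j)))
    (h.mul_left (m * 2 ^ s)) ?_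
  filter_upwards [eventually_ge_atTop 1,
    tendsto_natCast_atTop_atTop.eventually_ge_atTop (2 * (m * 2 ^ s))] with j hj hjm
  have hj' : (1 : ℝ) ≤ j := by exact_mod_cast hj
  have hwj := hw j
  have hf : |f (j + 1)| ≤ |f j| + |f (j + 1) - f j| := by
    simpa using abs_add_le (f j) (f (j + 1) - f j)
  have hpow : ((j : ℝ) + 1) ^ s ≤ 2 ^ s * (j : ℝ) ^ s := by
    rw [← mul_pow]
    gcongr
    linarith
  push_cast
  calc ((j : ℝ) + 1) ^ (s + 1) * |f (j + 1)| * poissonWeight m (j + 1)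
      = ((j : ℝ) + 1) ^ s * |f (j + 1)| * (((j : ℝ) + 1) * poissonWeight m (j + 1)) := by ring
    _ = ((j : ℝ) + 1) ^ s * |f (j + 1)| * (m * poissonWeight m j) := by
        rw [succ_mul_poissonWeight_succ]
    _ ≤ (2 ^ s * (j : ℝ) ^ s) * (|f j| + |f (j + 1) - f j|) * (m * poissonWeight m j) := by
        gcongr
    _ = (m * 2 ^ s) * ((j : ℝ) ^ s * |f j| * poissonWeight m j) +
        m * 2 ^ s * ((j : ℝ) ^ s * |f (j + 1) - f j| * poissonWeight m j) := by ring
    _ ≤ ((j : ℝ) / 2) * ((j : ℝ) ^ s * |f j| * poissonWeight m j) +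
        m * 2 ^ s * ((j : ℝ) ^ s * |f (j + 1) - f j| * poissonWeight m j) := by
        gcongr
        linarith
    _ = _ := by ring

/-- For a Poisson random variable `X` with mean `m > 0`, an integer `r ≥ 1`, a
real `a` and a function `f : ℕ → ℝ`, the following are equivalent
(finiteness of an expectation meaning absolute convergence of its defining series):
(i) `E[|(X − a)^r·f(X)|] < ∞`; (ii) `E[X^r·|f(X)|] < ∞`;
(iii) `E[X^{r-1}·|Δf(X)|] < ∞`; (iv) `E[|(X − a)^{r-1}·Δf(X)|] < ∞`;
where `Δf(j) = f(j+1) − f(j)`. -/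
theorem poisson_moment_integrability_equivalences
    (m : ℝ) (hm : 0 < m) (r : ℕ) (hr : 1 ≤ r) (a : ℝ) (f : ℕ → ℝ) :
    ((Summable fun j : ℕ => |((j : ℝ) - a) ^ r * f j| * poissonWeight m j) ↔
      (Summable fun j : ℕ => (j : ℝ) ^ r * |f j| * poissonWeight m j)) ∧
    ((Summable fun j : ℕ => (j : ℝ) ^ r * |f j| * poissonWeight m j) ↔
      (Summable fun j : ℕ =>
        (j : ℝ) ^ (r - 1) * |f (j + 1) - f j| * poissonWeight m j)) ∧
    ((Summable fun j : ℕ =>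
        (j : ℝ) ^ (r - 1) * |f (j + 1) - f j| * poissonWeight m j) ↔
      (Summable fun j : ℕ =>
        |((j : ℝ) - a) ^ (r - 1) * (f (j + 1) - f j)| * poissonWeight m j)) := by
  obtain ⟨s, rfl⟩ := Nat.exists_eq_add_of_le' hr
  rw [Nat.add_sub_cancel]
  exact ⟨summable_abs_natCast_sub_pow_mul_iff a (s + 1) f _,
    ⟨summable_pow_mul_abs_sub_mul_poissonWeight hm s f,
      summable_pow_succ_mul_abs_mul_poissonWeight hm s f⟩,
    (summable_abs_natCast_sub_pow_mul_iff a s (fun j => f (j + 1) - f j) _).symm⟩
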